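/- Suppose f satisfies (A1) and Behavior (B1) holds with limit point x̄. Then I_e(x̄) = I = {1,…,m} and ∇f_i(x̄) ∈ N(x̄) for all i ∈ I; in particular, the vectors ∇f_i(x̄), i ∈ I, are linearly dependent. -/

import Mathlib

open Filter Topology Matrix RealInnerProductSpace

noncomputable section

/-- Euclidean space ℝ^n. -/
abbrev Euc (n : ℕ) := EuclideanSpace ℝ (Fin n)

/-- Assumption (A1): `f` is a continuous selection of the `C¹` functions `φ i`,
whose gradients are locally Lipschitz continuous. -/
def A1 {n m : ℕ} (f : Euc n → ℝ) (φ : Fin m → Euc n → ℝ) : Prop :=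
  Continuous f ∧ (∀ x, ∃ i, f x = φ i x) ∧
    ∀ i, ContDiff ℝ 1 (φ i) ∧ LocallyLipschitz (gradient (φ i))

/-- The essentially active set `I_e(x)`. -/
def Ie {n m : ℕ} (f : Euc n → ℝ) (φ : Fin m → Euc n → ℝ) (x : Euc n) : Set (Fin m) :=
  {i | x ∈ closure (interior {y | f y = φ i y})}

/-- The set `I_g(x)` of essentially active indices whose gradient coincides with `∇f(x)`. -/
def Ig {n m : ℕ} (f : Euc n → ℝ) (φ : Fin m → Euc n → ℝ) (x : Euc n) : Set (Fin m) :=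
  {i | i ∈ Ie f φ x ∧ gradient f x = gradient (φ i) x}

/-- The space `N(x̄) = span{∇f_i(x̄) − ∇f_1(x̄) : i ∈ I}`. -/
def NSpace {n m : ℕ} [NeZero m] (φ : Fin m → Euc n → ℝ) (x : Euc n) : Submodule ℝ (Euc n) :=
  Submodule.span ℝ (Set.range fun i : Fin m => gradient (φ i) x - gradient (φ 0) x)

/-- `t` satisfies the Wolfe conditions at `x` in direction `p`. -/
def WolfeStep {n : ℕ} (f : Euc n → ℝ) (c1 c2 : ℝ) (x p : Euc n) (t : ℝ) : Prop :=
  DifferentiableAt ℝ f (x + t • p) ∧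
  f (x + t • p) ≤ f x + c1 * t * ⟪gradient f x, p⟫ ∧
  c2 * ⟪gradient f x, p⟫ ≤ ⟪gradient f (x + t • p), p⟫

/-- Behavior (B1). -/
def B1 {n m : ℕ} [NeZero m] (f : Euc n → ℝ) (φ : Fin m → Euc n → ℝ) (c1 c2 : ℝ)
    (x : ℕ → Euc n) (H : ℕ → Matrix (Fin n) (Fin n) ℝ) (t : ℕ → ℝ) (xbar : Euc n) : Prop :=
  (0 < c1 ∧ c1 < c2 ∧ c2 < 1) ∧
  (∀ k, (H k).IsSymm ∧ (H k).PosDef) ∧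
  (∀ k, x (k+1) = x k + t k • (-(Matrix.toEuclideanLin (H k) (gradient f (x k))))) ∧
  (∀ k, 0 < t k ∧
    WolfeStep f c1 c2 (x k) (-(Matrix.toEuclideanLin (H k) (gradient f (x k)))) (t k)) ∧
  (∀ k, DifferentiableAt ℝ f (x k) ∧ gradient f (x k) ≠ 0) ∧
  Tendsto x atTop (𝓝 xbar) ∧
  (∀ i : Fin m, {k | i ∈ Ig f φ (x k)}.Infinite) ∧
  (∃ σL σU : ℝ, 0 < σL ∧ σL ≤ σU ∧ ∀ k,
    (∀ v : Euc n, ⟪v, Matrix.toEuclideanLin (H k) v⟫ ≤ σU * ‖v‖ ^ 2) ∧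
    (∃ W : Submodule ℝ (Euc n),
      Module.finrank ℝ W = n - Module.finrank ℝ (NSpace φ xbar) ∧
      ∀ v ∈ W, σL * ‖v‖ ^ 2 ≤ ⟪v, Matrix.toEuclideanLin (H k) v⟫)) ∧
  (∀ i : Fin m, Tendsto
    (fun k => Matrix.toEuclideanLin (H k) (gradient (φ i) xbar - gradient (φ 0) xbar))
    atTop (𝓝 0))

section InnerProductSpace

variable {E : Type*} [NormedAddCommGroup E] [InnerProductSpace ℝ E]

/-- If `f` is a finite selection of functions differentiable at `x` and `f` is itself
differentiable at `x`, then its gradient there is the gradient of one of the selection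
functions. -/
theorem exists_gradient_eq_of_selection [CompleteSpace E] {ι : Type*} [Finite ι]
    {f : E → ℝ} {φ : ι → E → ℝ} {x : E} (hsel : ∀ y, ∃ i, f y = φ i y)
    (hf : DifferentiableAt ℝ f x) (hφ : ∀ i, DifferentiableAt ℝ (φ i) x) :
    ∃ i, gradient f x = gradient (φ i) x := by
  obtain ⟨i, hi⟩ := Subspace.exists_eq_top_of_iUnion_eq_univ
    (p := fun i => LinearMap.ker (innerₛₗ ℝ (gradient f x - gradient (φ i) x))) <| by
      refine Set.eq_univ_of_forall fun d => Set.mem_iUnion.2 ?_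
      have hfreq : ∃ᶠ s : ℝ in 𝓝[≠] 0, ∃ i, f (x + s • d) - φ i (x + s • d) = 0 :=
        (Eventually.of_forall fun s => (hsel (x + s • d)).imp fun i h => sub_eq_zero.2 h).frequently
      obtain ⟨i, hi⟩ := frequently_exists.1 hfreq
      refine ⟨i, ?_⟩
      by_contra hne
      have hline : HasDerivAt (fun s : ℝ => x + s • d) d 0 := by
        simpa using ((hasDerivAt_id (0 : ℝ)).smul_const d).const_add x
      have hgrad : HasFDerivAt (fun y => f y - φ i y)
          (innerSL ℝ (gradient f x - gradient (φ i) x)) (x + (0 : ℝ) • d) := by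
        rw [zero_smul, add_zero, map_sub]
        exact hf.hasGradientAt.hasFDerivAt.sub (hφ i).hasGradientAt.hasFDerivAt
      have hderiv : HasDerivAt (fun s : ℝ => f (x + s • d) - φ i (x + s • d))
          ⟪gradient f x - gradient (φ i) x, d⟫ 0 := by
        exact HasFDerivAt.comp_hasDerivAt (0 : ℝ) hgrad hline
      exact hi (hderiv.eventually_ne hne)
  refine ⟨i, sub_eq_zero.1 ?_⟩
  have hmem : gradient f x - gradient (φ i) x ∈
      LinearMap.ker (innerₛₗ ℝ (gradient f x - gradient (φ i) x)) := hi ▸ Submodule.mem_top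
  exact inner_self_eq_zero.1 (LinearMap.mem_ker.1 hmem)

/-- A positive operator whose quadratic form is bounded by `σ` satisfies
`‖T v‖² ≤ σ ⟪v, T v⟫`. -/
theorem LinearMap.IsSymmetric.norm_apply_sq_le {T : E →ₗ[ℝ] E} (hT : T.IsSymmetric)
    (hnonneg : ∀ v, 0 ≤ ⟪v, T v⟫) {σ : ℝ} (hσ : 0 < σ) (hle : ∀ v, ⟪v, T v⟫ ≤ σ * ‖v‖ ^ 2)
    (v : E) : ‖T v‖ ^ 2 ≤ σ * ⟪v, T v⟫ := by
  have hpos := hnonneg (σ • v - T v)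
  have hexp : ⟪σ • v - T v, T (σ • v - T v)⟫ =
      σ ^ 2 * ⟪v, T v⟫ - 2 * σ * ‖T v‖ ^ 2 + ⟪T v, T (T v)⟫ := by
    have hsymm : ⟪v, T (T v)⟫ = ‖T v‖ ^ 2 := by rw [← hT, real_inner_self_eq_norm_sq]
    simp only [map_sub, map_smul, inner_sub_left, inner_sub_right, real_inner_smul_left,
      real_inner_smul_right, hsymm, real_inner_self_eq_norm_sq]
    ring
  have hTv := hle (T v)
  refine le_of_mul_le_mul_left ?_ hσ
  nlinarith

theorem LinearMap.IsSymmetric.norm_apply_le {T : E →ₗ[ℝ] E} (hT : T.IsSymmetric)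
    (hnonneg : ∀ v, 0 ≤ ⟪v, T v⟫) {σ : ℝ} (hσ : 0 < σ) (hle : ∀ v, ⟪v, T v⟫ ≤ σ * ‖v‖ ^ 2)
    (v : E) : ‖T v‖ ≤ σ * ‖v‖ := by
  refine le_of_sq_le_sq ?_ (by positivity)
  nlinarith [hT.norm_apply_sq_le hnonneg hσ hle v, hle v]

/-- The vectors on which a sequence of linear maps converges pointwise to zero. -/
def nullLimit (T : ℕ → E →ₗ[ℝ] E) : Submodule ℝ E where
  carrier := {v | Tendsto (fun k => T k v) atTop (𝓝 0)}
  add_mem' {v w} hv hw := by simpa using Tendsto.add hv hw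
  zero_mem' := by simp
  smul_mem' c v hv := by simpa using Tendsto.const_smul hv c

theorem mem_nullLimit {T : ℕ → E →ₗ[ℝ] E} {v : E} :
    v ∈ nullLimit T ↔ Tendsto (fun k => T k v) atTop (𝓝 0) := Iff.rfl

/-- Pointwise convergence to zero on a finite-dimensional subspace is uniform on bounded sets. -/
theorem exists_tendsto_zero_norm_apply_le [FiniteDimensional ℝ E] {T : ℕ → E →ₗ[ℝ] E}
    {M : Submodule ℝ E} (hM : M ≤ nullLimit T) :
    ∃ ε : ℕ → ℝ, Tendsto ε atTop (𝓝 0) ∧ ∀ k, ∀ v ∈ M, ‖T k v‖ ≤ ε k * ‖v‖ := by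
  let b := stdOrthonormalBasis ℝ M
  refine ⟨fun k => ∑ j, ‖T k (b j)‖, ?_, fun k v hv => ?_⟩
  · simpa using tendsto_finsetSum Finset.univ fun j _ => (mem_nullLimit.1 (hM (b j).2)).norm
  · have hv' : v = ∑ j, ⟪b j, ⟨v, hv⟩⟫ • (b j : E) := by
      simpa using! congrArg (M.subtype) (b.sum_repr' ⟨v, hv⟩).symm
    calc ‖T k v‖ = ‖∑ j, ⟪b j, (⟨v, hv⟩ : M)⟫ • T k (b j)‖ := by
          conv_lhs => rw [hv']
          simp only [map_sum, map_smul]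
      _ ≤ ∑ j, ‖T k (b j)‖ * ‖v‖ := by
          refine norm_sum_le_of_le _ fun j _ => ?_
          rw [norm_smul, mul_comm]
          gcongr
          simpa using norm_inner_le_norm (𝕜 := ℝ) (b j) (⟨v, hv⟩ : M)
      _ = _ := by rw [Finset.sum_mul]

/-- If each `T k` is bounded below by a positive constant on a subspace of codimension `d`, then
`T k → 0` cannot hold pointwise on a space of dimension larger than `d`. -/
theorem finrank_nullLimit_le [FiniteDimensional ℝ E] {T : ℕ → E →ₗ[ℝ] E} {σ : ℝ} (hσ : 0 < σ)
    {d : ℕ} (hW : ∀ k, ∃ W : Submodule ℝ E, Module.finrank ℝ W = Module.finrank ℝ E - d ∧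
      ∀ v ∈ W, σ * ‖v‖ ^ 2 ≤ ⟪v, T k v⟫) :
    Module.finrank ℝ (nullLimit T) ≤ d := by
  by_contra! hlt
  obtain ⟨ε, hε, hbound⟩ := exists_tendsto_zero_norm_apply_le (le_refl (nullLimit T))
  obtain ⟨k, hk⟩ := (hε.eventually_lt_const hσ).exists
  obtain ⟨W, hWdim, hWlow⟩ := hW k
  have hinf : nullLimit T ⊓ W ≠ ⊥ := by
    intro hbot
    have h := Submodule.finrank_sup_add_finrank_inf_eq (nullLimit T) W
    rw [hbot, finrank_bot] at h
    have := Submodule.finrank_le (nullLimit T ⊔ W)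
    omega
  obtain ⟨v, ⟨hvM, hvW⟩, hv⟩ := Submodule.exists_mem_ne_zero_of_ne_bot hinf
  have hvpos : 0 < ‖v‖ := norm_pos_iff.2 hv
  have : σ * ‖v‖ ^ 2 ≤ ε k * ‖v‖ ^ 2 := calc
    σ * ‖v‖ ^ 2 ≤ ⟪v, T k v⟫ := hWlow v hvW
    _ ≤ ‖v‖ * ‖T k v‖ := real_inner_le_norm _ _
    _ ≤ ‖v‖ * (ε k * ‖v‖) := by gcongr; exact hbound k v hvM
    _ = ε k * ‖v‖ ^ 2 := by ring
  exact hk.not_ge (le_of_mul_le_mul_right this (by positivity))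

/-- Suppose `G k` accumulates only at finitely many vectors `g i`, whose differences are
asymptotically annihilated by the positive operators `T k`. If the curvature condition
`⟪G (k + 1), -T k (G k)⟫ ≥ c ⟪G k, -T k (G k)⟫` holds with `c < 1`, then `T k` asymptotically
annihilates the vectors `g i` themselves. -/
theorem tendsto_apply_zero_of_curvature {ι : Type*} [Fintype ι] {T : ℕ → E →ₗ[ℝ] E}
    {G : ℕ → E} {g : ι → E} {i₀ : ι} {e : ℕ → ℝ} {c σ : ℝ} (hc : c < 1) (hσ : 0 < σ)
    (hsymm : ∀ k, (T k).IsSymmetric) (hnonneg : ∀ k v, 0 ≤ ⟪v, T k v⟫)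
    (hle : ∀ k v, ⟪v, T k v⟫ ≤ σ * ‖v‖ ^ 2)
    (he : Tendsto e atTop (𝓝 0)) (hG : ∀ k, ∃ i, ‖G k - g i‖ ≤ e k)
    (hT : ∀ i, Tendsto (fun k => T k (g i - g i₀)) atTop (𝓝 0))
    (hcurv : ∀ k, c * ⟪G k, -T k (G k)⟫ ≤ ⟪G (k + 1), -T k (G k)⟫) :
    Tendsto (fun k => T k (g i₀)) atTop (𝓝 0) := by
  set η : ℕ → ℝ := fun k => ∑ i, ‖T k (g i - g i₀)‖
  have hη0 : Tendsto η atTop (𝓝 0) := by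
    simpa [η] using! tendsto_finsetSum Finset.univ fun i _ => (hT i).norm
  have hdiff (k l : ℕ) : ‖T k (G l - g i₀)‖ ≤ σ * e l + η k := by
    obtain ⟨i, hi⟩ := hG l
    calc ‖T k (G l - g i₀)‖ = ‖T k (G l - g i) + T k (g i - g i₀)‖ := by
          rw [← map_add, sub_add_sub_cancel]
      _ ≤ ‖T k (G l - g i)‖ + ‖T k (g i - g i₀)‖ := norm_add_le _ _
      _ ≤ σ * e l + η k := by
          gcongr
          · exact ((hsymm k).norm_apply_le (hnonneg k) hσ (hle k) _).trans (by gcongr)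
          · exact Finset.single_le_sum (f := fun i => ‖T k (g i - g i₀)‖)
              (fun _ _ => norm_nonneg _) (Finset.mem_univ i)
  have hGbound (k : ℕ) : ‖G k‖ ≤ e k + ∑ i, ‖g i‖ := by
    obtain ⟨i, hi⟩ := hG k
    have h := norm_add_le (G k - g i) (g i)
    rw [sub_add_cancel] at h
    have := Finset.single_le_sum (f := fun i => ‖g i‖)
      (fun _ _ => norm_nonneg _) (Finset.mem_univ i)
    linarith
  have hcurv' (k : ℕ) : (1 - c) * ⟪G k, T k (G k)⟫ ≤
      ((σ * e (k + 1) + η k) + (σ * e k + η k)) * (e k + ∑ i, ‖g i‖) := by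
    have h1 : (1 - c) * ⟪G k, T k (G k)⟫ ≤ ⟪T k (G k - G (k + 1)), G k⟫ := by
      have h := hcurv k
      rw [hsymm k, inner_sub_left]
      simp only [inner_neg_right] at h
      linarith
    have h2 : T k (G k - G (k + 1)) = T k (G k - g i₀) - T k (G (k + 1) - g i₀) := by
      rw [← map_sub, sub_sub_sub_cancel_right]
    have h3 : ‖T k (G k - G (k + 1))‖ ≤ (σ * e (k + 1) + η k) + (σ * e k + η k) := by
      rw [h2]
      linarith [norm_sub_le (T k (G k - g i₀)) (T k (G (k + 1) - g i₀)), hdiff k k,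
        hdiff k (k + 1)]
    exact h1.trans ((real_inner_le_norm _ _).trans
      (mul_le_mul h3 (hGbound k) (norm_nonneg _) ((norm_nonneg _).trans h3)))
  have hlim : Tendsto (fun k => σ * (((σ * e (k + 1) + η k) + (σ * e k + η k)) *
      (e k + ∑ i, ‖g i‖) / (1 - c))) atTop (𝓝 0) := by
    have he' := (tendsto_add_atTop_iff_nat 1).2 he
    simpa using (((((he'.const_mul σ).add hη0).add ((he.const_mul σ).add hη0)).mul
      (he.add_const (∑ i, ‖g i‖))).div_const (1 - c)).const_mul σ
  have hsq : Tendsto (fun k => ‖T k (G k)‖ ^ 2) atTop (𝓝 0) := by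
    refine squeeze_zero (fun k => by positivity) (fun k => ?_) hlim
    refine ((hsymm k).norm_apply_sq_le (hnonneg k) hσ (hle k) _).trans ?_
    gcongr
    rw [le_div_iff₀ (by linarith), mul_comm]
    exact hcurv' k
  have hTG : Tendsto (fun k => T k (G k)) atTop (𝓝 0) := by
    rw [tendsto_zero_iff_norm_tendsto_zero]
    simpa [Real.sqrt_sq] using hsq.sqrt
  have hTd : Tendsto (fun k => T k (G k - g i₀)) atTop (𝓝 0) :=
    squeeze_zero_norm (fun k => hdiff k k) (by simpa using (he.const_mul σ).add hη0)
  simpa using hTG.sub hTd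

end InnerProductSpace

/-- Finitely many vectors one of which lies in the span of their differences to it are linearly
dependent. -/
theorem not_linearIndependent_of_mem_span_sub {V ι : Type*} [AddCommGroup V] [Module ℝ V]
    [Fintype ι] {g : ι → V} {i₀ : ι}
    (h : g i₀ ∈ Submodule.span ℝ (Set.range fun i => g i - g i₀)) :
    ¬ LinearIndependent ℝ g := by
  classical
  intro hli
  obtain ⟨c, hc⟩ := (Submodule.mem_span_range_iff_exists_fun ℝ).1 h
  rw [Fintype.linearIndependent_iff] at hli
  have hzero := hli (fun i => c i - if i = i₀ then 1 + ∑ j, c j else 0) <| by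
    simp only [smul_sub, Finset.sum_sub_distrib, ← Finset.sum_smul] at hc
    simp only [sub_smul, Finset.sum_sub_distrib, ite_smul, zero_smul, Finset.sum_ite_eq',
      Finset.mem_univ, if_true, add_smul, one_smul]
    rw [sub_eq_iff_eq_add] at hc
    rw [hc, sub_self]
  have hsum : ∑ i, (c i - if i = i₀ then 1 + ∑ j, c j else 0) = 0 :=
    Finset.sum_eq_zero fun i _ => hzero i
  simp at hsum

/-- Lemma `lem:intermediate_result`: under (A1) and Behavior (B1),
`I_e(x̄) = I`, every `∇f_i(x̄)` lies in `N(x̄)`, and the vectors `∇f_i(x̄)`, `i ∈ I`,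
are linearly dependent. -/
theorem intermediate_result {n m : ℕ} [NeZero m] (f : Euc n → ℝ) (φ : Fin m → Euc n → ℝ)
    (c1 c2 : ℝ) (x : ℕ → Euc n) (H : ℕ → Matrix (Fin n) (Fin n) ℝ) (t : ℕ → ℝ)
    (xbar : Euc n) (hA1 : A1 f φ) (hB1 : B1 f φ c1 c2 x H t xbar) :
    Ie f φ xbar = Set.univ ∧
    (∀ i : Fin m, gradient (φ i) xbar ∈ NSpace φ xbar) ∧
    ¬ LinearIndependent ℝ (fun i : Fin m => gradient (φ i) xbar) := by
  obtain ⟨-, hsel, hφ⟩ := hA1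
  obtain ⟨⟨-, -, hc2⟩, hH, hstepeq, hstep, hdiff, hx, hinf, ⟨σL, σU, hσL, hσ, hHσ⟩, hN⟩ := hB1
  have hdiffφ (i : Fin m) (y : Euc n) : DifferentiableAt ℝ (φ i) y :=
    ((hφ i).1.differentiable one_ne_zero) y
  have hpos (k : ℕ) : (Matrix.toEuclideanLin (H k)).IsPositive :=
    Matrix.isPositive_toEuclideanLin_iff.2 (hH k).2.posSemidef
  have hcurv : Tendsto (fun k => Matrix.toEuclideanLin (H k) (gradient (φ 0) xbar))
      atTop (𝓝 0) := by
    refine tendsto_apply_zero_of_curvature (T := fun k => Matrix.toEuclideanLin (H k))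
      (G := fun k => gradient f (x k)) (g := fun i => gradient (φ i) xbar)
      (e := fun k => ∑ i, ‖gradient (φ i) (x k) - gradient (φ i) xbar‖)
      hc2 (hσL.trans_le hσ) (fun k => (hpos k).isSymmetric)
      (fun k v => by simpa using (hpos k).re_inner_nonneg_right v)
      (fun k => (hHσ k).1) ?_ (fun k => ?_) hN (fun k => ?_)
    · have hlim (i : Fin m) : Tendsto (fun k => ‖gradient (φ i) (x k) - gradient (φ i) xbar‖)
          atTop (𝓝 0) :=
        tendsto_iff_norm_sub_tendsto_zero.1 (((hφ i).2.continuous.tendsto xbar).comp hx)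
      simpa using tendsto_finsetSum Finset.univ fun i _ => hlim i
    · obtain ⟨i, hi⟩ := exists_gradient_eq_of_selection hsel (hdiff k).1 fun i => hdiffφ i (x k)
      refine ⟨i, ?_⟩
      rw [hi]
      exact Finset.single_le_sum (f := fun i => ‖gradient (φ i) (x k) - gradient (φ i) xbar‖)
        (fun _ _ => norm_nonneg _) (Finset.mem_univ i)
    · have h := (hstep k).2.2.2
      rwa [← hstepeq k] at h
  have hNle : NSpace φ xbar ≤ nullLimit fun k => Matrix.toEuclideanLin (H k) :=
    Submodule.span_le.2 (Set.range_subset_iff.2 hN)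
  have hNeq : NSpace φ xbar = nullLimit fun k => Matrix.toEuclideanLin (H k) :=
    Submodule.eq_of_le_of_finrank_le hNle <|
      finrank_nullLimit_le hσL fun k => by simpa using (hHσ k).2
  have hmem0 : gradient (φ 0) xbar ∈ NSpace φ xbar := hNeq ▸ mem_nullLimit.2 hcurv
  refine ⟨Set.eq_univ_of_forall fun i => ?_, fun i => ?_,
    not_linearIndependent_of_mem_span_sub hmem0⟩
  · exact isClosed_closure.mem_of_frequently_of_tendsto
      ((Nat.frequently_atTop_iff_infinite.2 (hinf i)).mono fun k hk => hk.1) hx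
  · have hsub : gradient (φ i) xbar - gradient (φ 0) xbar ∈ NSpace φ xbar :=
      Submodule.subset_span (Set.mem_range_self i)
    simpa using add_mem hsub hmem0
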